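/- Let n ≥ 1, s ∈ (1/2,1), C_s > 0, ε, τ > 0 with τ ≤ s ε^{2s}/C_s. Let u₀: ℝⁿ → ℝ be bounded and uniformly continuous and let (U^j) be the solution of the semi-discrete scheme with initial datum u₀. Then the scheme preserves the spatial modulus of continuity: for every y ∈ ℝⁿ and every j ∈ ℕ, sup_{x∈ℝⁿ} |U^j(x+y) − U^j(x)| ≤ ω_{u₀}(|y|), where ω_{u₀}(r) := sup_{|z|≤r} sup_{x∈ℝⁿ} |u₀(x+z) − u₀(x)|. -/

import Mathlib

open MeasureTheory Metric Set

noncomputable section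

abbrev E (n : ℕ) : Type := EuclideanSpace ℝ (Fin n)

/-- The truncated infinity fractional Laplacian
`L_ε[φ](x) = C_s ⋅ sup_{|y|=1} inf_{|ŷ|=1} ∫_ε^∞ (φ(x+ηy)+φ(x−ηŷ)−2φ(x)) η^{−1−2s} dη`. -/
def iflTrunc (n : ℕ) (s Cs ε : ℝ) (φ : E n → ℝ) (x : E n) : ℝ :=
  Cs * ⨆ y : {y : E n // ‖y‖ = 1}, ⨅ yt : {y : E n // ‖y‖ = 1},
    ∫ η in Ioi ε,
      (φ (x + η • (y : E n)) + φ (x - η • (yt : E n)) - 2 * φ x) / η ^ (1 + 2*s)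

theorem integrableOn_inv_rpow {s ε : ℝ} (hs : 0 < s) (hε : 0 < ε) :
    IntegrableOn (fun η : ℝ => (η ^ (1 + 2 * s))⁻¹) (Ioi ε) := by
  refine (integrableOn_Ioi_rpow_of_lt (a := -(1 + 2 * s)) (by linarith) hε).congr_fun ?_
    measurableSet_Ioi
  intro η hη
  exact Real.rpow_neg (hε.trans hη).le _

theorem integral_inv_rpow {s ε : ℝ} (hs : 0 < s) (hε : 0 < ε) :
    ∫ η in Ioi ε, (η ^ (1 + 2 * s))⁻¹ = (ε ^ (2 * s))⁻¹ / (2 * s) := by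
  have h : ∫ η in Ioi ε, (η ^ (1 + 2 * s))⁻¹ = ∫ η in Ioi ε, η ^ (-(1 + 2 * s)) :=
    setIntegral_congr_fun measurableSet_Ioi fun η hη => (Real.rpow_neg (hε.trans hη).le _).symm
  rw [h, integral_Ioi_rpow_of_lt (by linarith) hε, ← Real.rpow_neg hε.le]
  have e : -(1 + 2 * s) + 1 = -(2 * s) := by ring
  rw [e, neg_div_neg_eq]

section SecondDifference

variable {n : ℕ} {s ε M : ℝ} {φ ψ : E n → ℝ}

theorem abs_secondDifference_le (hφM : ∀ z, |φ z| ≤ M) (a b c : E n) :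
    |φ a + φ b - 2 * φ c| ≤ 4 * M := by
  have ha := abs_le.1 (hφM a)
  have hb := abs_le.1 (hφM b)
  have hc := abs_le.1 (hφM c)
  exact abs_le.2 ⟨by linarith, by linarith⟩

theorem integrableOn_secondDifference (hs : 0 < s) (hε : 0 < ε) (hφ : Continuous φ)
    (hφM : ∀ z, |φ z| ≤ M) (x y yt : E n) :
    IntegrableOn (fun η : ℝ => (φ (x + η • y) + φ (x - η • yt) - 2 * φ x) / η ^ (1 + 2 * s))
      (Ioi ε) := by
  simp only [div_eq_mul_inv]
  refine (integrableOn_inv_rpow hs hε).bdd_mul (c := 4 * M) ?_ ?_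
  · exact Continuous.aestronglyMeasurable (by fun_prop)
  · exact Filter.Eventually.of_forall fun η => abs_secondDifference_le hφM _ _ _

theorem abs_integral_secondDifference_le (hs : 0 < s) (hε : 0 < ε)
    (hφM : ∀ z, |φ z| ≤ M) (x y yt : E n) :
    |∫ η in Ioi ε, (φ (x + η • y) + φ (x - η • yt) - 2 * φ x) / η ^ (1 + 2 * s)| ≤
      4 * M * ∫ η in Ioi ε, (η ^ (1 + 2 * s))⁻¹ := by
  rw [← integral_const_mul, ← Real.norm_eq_abs]
  refine norm_integral_le_of_norm_le ((integrableOn_inv_rpow hs hε).const_mul _) ?_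
  filter_upwards [ae_restrict_mem measurableSet_Ioi] with η hη
  have hpos : 0 < η ^ (1 + 2 * s) := Real.rpow_pos_of_pos (hε.trans hη) _
  rw [Real.norm_eq_abs, abs_div, abs_of_pos hpos, div_eq_mul_inv]
  gcongr
  exact abs_secondDifference_le hφM _ _ _

theorem integral_secondDifference_le_add (hs : 0 < s) (hε : 0 < ε)
    (hφ : Continuous φ) (hψ : Continuous ψ) (hφM : ∀ z, |φ z| ≤ M) (hψM : ∀ z, |ψ z| ≤ M)
    {x x' : E n} {K : ℝ} (h : ∀ v, φ (x + v) ≤ ψ (x' + v) + K) (y yt : E n) :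
    ∫ η in Ioi ε, (φ (x + η • y) + φ (x - η • yt) - 2 * φ x) / η ^ (1 + 2 * s) ≤
      (∫ η in Ioi ε, (ψ (x' + η • y) + ψ (x' - η • yt) - 2 * ψ x') / η ^ (1 + 2 * s)) +
        2 * (ψ x' + K - φ x) * ∫ η in Ioi ε, (η ^ (1 + 2 * s))⁻¹ := by
  have hc := (integrableOn_inv_rpow hs hε).const_mul (2 * (ψ x' + K - φ x))
  have hI := integrableOn_secondDifference hs hε hψ hψM x' y yt
  rw [← integral_const_mul, ← integral_add hI hc]
  refine setIntegral_mono_on (integrableOn_secondDifference hs hε hφ hφM x y yt) (hI.add hc)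
    measurableSet_Ioi fun η hη => ?_
  have hpos : 0 < η ^ (1 + 2 * s) := Real.rpow_pos_of_pos (hε.trans hη) _
  have h1 := h (η • y)
  have h2 := h (-(η • yt))
  rw [← sub_eq_add_neg, ← sub_eq_add_neg] at h2
  rw [div_eq_mul_inv, div_eq_mul_inv, ← add_mul]
  exact mul_le_mul_of_nonneg_right (by linarith) (inv_pos.2 hpos).le

end SecondDifference

theorem iSup_iInf_le_iSup_iInf_add {ι κ : Type*} [Nonempty ι] [Nonempty κ] {f g : ι → κ → ℝ}
    {B c : ℝ} (hf : ∀ i k, |f i k| ≤ B) (hg : ∀ i k, |g i k| ≤ B)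
    (h : ∀ i k, f i k ≤ g i k + c) :
    ⨆ i, ⨅ k, f i k ≤ (⨆ i, ⨅ k, g i k) + c := by
  have bf (i) : BddBelow (range (f i)) := ⟨-B, by rintro _ ⟨k, rfl⟩; exact (abs_le.1 (hf i k)).1⟩
  have bg (i) : BddBelow (range (g i)) := ⟨-B, by rintro _ ⟨k, rfl⟩; exact (abs_le.1 (hg i k)).1⟩
  have bs : BddAbove (range fun i => ⨅ k, g i k) := by
    refine ⟨B, ?_⟩
    rintro _ ⟨i, rfl⟩
    exact ciInf_le_of_le (bg i) (Classical.arbitrary κ) (abs_le.1 (hg i _)).2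
  refine ciSup_le fun i => ?_
  have h1 : (⨅ k, f i k) - c ≤ ⨅ k, g i k :=
    le_ciInf fun k => by linarith [ciInf_le (bf i) k, h i k]
  linarith [le_ciSup bs i]

theorem explicitStep_le_add {n : ℕ} (hn : 1 ≤ n) {s Cs ε τ M : ℝ} (hs : 0 < s) (hCs : 0 < Cs)
    (hε : 0 < ε) (hτ : 0 < τ) (hCFL : τ ≤ s * ε ^ (2 * s) / Cs) {φ ψ : E n → ℝ}
    (hφ : Continuous φ) (hψ : Continuous ψ) (hφM : ∀ z, |φ z| ≤ M) (hψM : ∀ z, |ψ z| ≤ M)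
    {x x' : E n} {K : ℝ} (h : ∀ v, φ (x + v) ≤ ψ (x' + v) + K) :
    φ x + τ * iflTrunc n s Cs ε φ x ≤ ψ x' + τ * iflTrunc n s Cs ε ψ x' + K := by
  have : Nonempty {y : E n // ‖y‖ = 1} := ⟨⟨EuclideanSpace.single ⟨0, hn⟩ 1, by simp⟩⟩
  have key := iSup_iInf_le_iSup_iInf_add
    (fun y yt : {y : E n // ‖y‖ = 1} => abs_integral_secondDifference_le hs hε hφM x y.1 yt.1)
    (fun y yt : {y : E n // ‖y‖ = 1} => abs_integral_secondDifference_le hs hε hψM x' y.1 yt.1)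
    (fun y yt => integral_secondDifference_le_add hs hε hφ hψ hφM hψM h y.1 yt.1)
  have hL := mul_le_mul_of_nonneg_left key (mul_pos hτ hCs).le
  have h0 : 0 ≤ ψ x' + K - φ x := by simpa using h 0
  have hA : τ * Cs * (2 * ∫ η in Ioi ε, (η ^ (1 + 2 * s))⁻¹) ≤ 1 := by
    have hp : 0 < ε ^ (2 * s) := Real.rpow_pos_of_pos hε _
    rw [le_div_iff₀ hCs] at hCFL
    rw [integral_inv_rpow hs hε]
    calc τ * Cs * (2 * ((ε ^ (2 * s))⁻¹ / (2 * s)))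
        ≤ s * ε ^ (2 * s) * (2 * ((ε ^ (2 * s))⁻¹ / (2 * s))) := by gcongr
      _ = 1 := by field_simp
  have hB := mul_le_mul_of_nonneg_right hA h0
  simp only [iflTrunc]
  linarith

theorem abs_explicitStep_le {n : ℕ} (hn : 1 ≤ n) {s Cs ε τ M : ℝ} (hs : 0 < s) (hCs : 0 < Cs)
    (hε : 0 < ε) (hτ : 0 < τ) (hCFL : τ ≤ s * ε ^ (2 * s) / Cs) {φ : E n → ℝ}
    (hφ : Continuous φ) (hφM : ∀ z, |φ z| ≤ M) (x : E n) :
    |φ x + τ * iflTrunc n s Cs ε φ x| ≤ M := by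
  have hM : 0 ≤ M := (abs_nonneg _).trans (hφM 0)
  have hz : ∀ z : E n, |(fun _ => 0 : E n → ℝ) z| ≤ M := fun z => by simpa using hM
  have h0 : iflTrunc n s Cs ε (fun _ => 0) x = 0 := by simp [iflTrunc]
  have h1 := explicitStep_le_add hn hs hCs hε hτ hCFL hφ continuous_const hφM hz
    (x := x) (x' := x) (K := M) fun v => by linarith [(abs_le.1 (hφM (x + v))).2]
  have h2 := explicitStep_le_add hn hs hCs hε hτ hCFL continuous_const hφ hz hφM
    (x := x) (x' := x) (K := M) fun v => by linarith [(abs_le.1 (hφM (x + v))).1]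
  rw [h0] at h1 h2
  exact abs_le.2 ⟨by linarith, by linarith⟩

/-- the semi-discrete scheme preserves the spatial modulus of continuity:
`sup_x |U^j(x+y) − U^j(x)| ≤ ω_{u₀}(|y|)` where
`ω_{u₀}(r) = sup_{|z|≤r} sup_x |u₀(x+z) − u₀(x)|`. -/
theorem scheme_equicontinuity_space
    (n : ℕ) (hn : 1 ≤ n) (s Cs : ℝ) (hs : s ∈ Ioo (1/2 : ℝ) 1) (hCs : 0 < Cs)
    (ε τ : ℝ) (hε : 0 < ε) (hτ : 0 < τ) (hCFL : τ ≤ s * ε ^ (2*s) / Cs)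
    (u₀ : E n → ℝ) (hb : ∃ M, ∀ z, |u₀ z| ≤ M) (huc : UniformContinuous u₀)
    (U : ℕ → E n → ℝ) (hU0 : U 0 = u₀)
    (hUrec : ∀ j x, U (j+1) x = U j x + τ * iflTrunc n s Cs ε (U j) x) :
    ∀ (j : ℕ) (y x : E n),
      |U j (x + y) - U j x| ≤
        ⨆ z : {z : E n // ‖z‖ ≤ ‖y‖}, ⨆ x' : E n, |u₀ (x' + (z : E n)) - u₀ x'| := by
  obtain ⟨M, hM⟩ := hb
  have hs0 : 0 < s := by linarith [hs.1]
  have hdiff (z x' : E n) : |u₀ (x' + z) - u₀ x'| ≤ 2 * M := by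
    have h1 := abs_le.1 (hM (x' + z))
    have h2 := abs_le.1 (hM x')
    exact abs_le.2 ⟨by linarith, by linarith⟩
  set ω : E n → ℝ :=
    fun y => ⨆ z : {z : E n // ‖z‖ ≤ ‖y‖}, ⨆ x' : E n, |u₀ (x' + (z : E n)) - u₀ x'|
  have hω0 (y x : E n) : |u₀ (x + y) - u₀ x| ≤ ω y := by
    have b1 : BddAbove (range fun x' : E n => |u₀ (x' + y) - u₀ x'|) :=
      ⟨2 * M, by rintro _ ⟨x', rfl⟩; exact hdiff y x'⟩
    have b2 : BddAbove (range fun z : {z : E n // ‖z‖ ≤ ‖y‖} =>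
        ⨆ x' : E n, |u₀ (x' + (z : E n)) - u₀ x'|) :=
      ⟨2 * M, by rintro _ ⟨z, rfl⟩; exact ciSup_le fun x' => hdiff z x'⟩
    exact (le_ciSup b1 x).trans (le_ciSup b2 ⟨y, le_rfl⟩)
  have hωsmall : ∀ e > 0, ∃ δ > 0, ∀ y : E n, ‖y‖ < δ → ω y ≤ e := by
    intro e he
    obtain ⟨δ, hδ, h⟩ := Metric.uniformContinuous_iff.1 huc e he
    refine ⟨δ, hδ, fun y hy => ?_⟩
    have : Nonempty {z : E n // ‖z‖ ≤ ‖y‖} := ⟨⟨y, le_rfl⟩⟩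
    refine ciSup_le fun z => ciSup_le fun x' => ?_
    rw [← Real.dist_eq]
    refine (h ?_).le
    simpa [dist_eq_norm] using z.2.trans_lt hy
  have hcont {φ : E n → ℝ} (h : ∀ y x, |φ (x + y) - φ x| ≤ ω y) : Continuous φ := by
    refine Metric.continuous_iff.2 fun x e he => ?_
    obtain ⟨δ, hδ, hd⟩ := hωsmall (e / 2) (half_pos he)
    refine ⟨δ, hδ, fun a ha => ?_⟩
    have h1 := h (a - x) x
    rw [add_sub_cancel] at h1
    rw [Real.dist_eq]
    linarith [hd (a - x) (by rwa [← dist_eq_norm])]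
  have main (j : ℕ) : (∀ z, |U j z| ≤ M) ∧ ∀ y x, |U j (x + y) - U j x| ≤ ω y := by
    induction j with
    | zero => exact hU0 ▸ ⟨hM, hω0⟩
    | succ j ih =>
      obtain ⟨hjM, hj⟩ := ih
      have hc := hcont hj
      refine ⟨fun z => hUrec j z ▸ abs_explicitStep_le hn hs0 hCs hε hτ hCFL hc hjM z,
        fun y x => ?_⟩
      have h1 := explicitStep_le_add hn hs0 hCs hε hτ hCFL hc hc hjM hjM
        (x := x + y) (x' := x) (K := ω y) fun v => by
          have := (abs_le.1 (hj y (x + v))).2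
          rw [add_right_comm] at this
          linarith
      have h2 := explicitStep_le_add hn hs0 hCs hε hτ hCFL hc hc hjM hjM
        (x := x) (x' := x + y) (K := ω y) fun v => by
          have := (abs_le.1 (hj y (x + v))).1
          rw [add_right_comm] at this
          linarith
      rw [hUrec, hUrec]
      exact abs_le.2 ⟨by linarith, by linarith⟩
  exact fun j => (main j).2
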